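/- Let X_1,…,X_K be mutually independent finitely-valued random variables, let (X_1,…,X_K,Y,Z) be jointly distributed, let 𝒦′ ⊆ 𝒦 and write 𝒦̄′ = 𝒦∖𝒦′. Then the following two conditions are equivalent: (i) I(X_S;Y|X_{𝒦∖S}) − I(X_S;Z|X_{𝒦̄′}) ≥ 0 for every S ⊆ 𝒦′; (ii) I(X_{S∪T};Y|X_{𝒦∖(S∪T)}) − I(X_{S′};Z|X_{𝒦̄′}) ≥ 0 for every S ⊆ 𝒦′, every S′ ⊆ S and every T ⊆ 𝒦̄′. -/

import Mathlib

open scoped Classical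

noncomputable section

/-- Probability that random variable `X` takes value `x`, under pmf `p` on a finite sample space. -/
def probOf {Ω α : Type} [Fintype Ω] (p : Ω → ℝ) (X : Ω → α) (x : α) : ℝ :=
  ∑ ω, if X ω = x then p ω else 0

/-- Shannon entropy of a finitely-valued random variable. -/
def Hent {Ω α : Type} [Fintype Ω] [Fintype α] (p : Ω → ℝ) (X : Ω → α) : ℝ :=
  -∑ x, probOf p X x * Real.log (probOf p X x)

/-- Conditional entropy `H(X | C)`. -/
def condHent {Ω α γ : Type} [Fintype Ω] [Fintype α] [Fintype γ]
    (p : Ω → ℝ) (X : Ω → α) (C : Ω → γ) : ℝ :=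
  Hent p (fun ω => (X ω, C ω)) - Hent p C

/-- Conditional mutual information `I(A;B | C)`. -/
def IcondMut {Ω α β γ : Type} [Fintype Ω] [Fintype α] [Fintype β] [Fintype γ]
    (p : Ω → ℝ) (A : Ω → α) (B : Ω → β) (C : Ω → γ) : ℝ :=
  condHent p A C + condHent p B C - condHent p (fun ω => (A ω, B ω)) C

/-- Mutual information `I(A;B)`. -/
def Imut {Ω α β : Type} [Fintype Ω] [Fintype α] [Fintype β]
    (p : Ω → ℝ) (A : Ω → α) (B : Ω → β) : ℝ :=
  Hent p A + Hent p B - Hent p (fun ω => (A ω, B ω))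

/-- `p` is a probability mass function. -/
def IsPMF {Ω : Type} [Fintype Ω] (p : Ω → ℝ) : Prop :=
  (∀ ω, 0 ≤ p ω) ∧ ∑ ω, p ω = 1

/-- The tuple `X_S = (X_k)_{k ∈ S}` as a random variable. -/
def tup {Ω ι : Type} {𝒳 : ι → Type} (X : ∀ k, Ω → 𝒳 k) (S : Finset ι) :
    Ω → ∀ k : S, 𝒳 k.1 :=
  fun ω k => X k.1 ω

/-- The random variables `X_1, …, X_K` are mutually independent. -/
def MutIndep {Ω ι : Type} [Fintype Ω] [Fintype ι] {𝒳 : ι → Type} [∀ k, Fintype (𝒳 k)]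
    (p : Ω → ℝ) (X : ∀ k, Ω → 𝒳 k) : Prop :=
  ∀ x : ∀ k, 𝒳 k, probOf p (fun ω k => X k ω) x = ∏ k, probOf p (X k) (x k)

/-- A marginal expectation, computed on the sample space. -/
theorem sum_probOf_mul {Ω α : Type} [Fintype Ω] [Fintype α] (p : Ω → ℝ) (X : Ω → α)
    (g : α → ℝ) : ∑ x, probOf p X x * g x = ∑ ω, p ω * g (X ω) := by
  simp only [probOf, Finset.sum_mul]
  rw [Finset.sum_comm]
  refine Finset.sum_congr rfl fun ω _ => ?_
  simp [ite_mul]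

theorem probOf_nonneg {Ω α : Type} [Fintype Ω] {p : Ω → ℝ} (hp : ∀ ω, 0 ≤ p ω)
    (X : Ω → α) (x : α) : 0 ≤ probOf p X x :=
  Finset.sum_nonneg fun ω _ => by split_ifs <;> simp [hp]

theorem probOf_apply_pos {Ω α : Type} [Fintype Ω] {p : Ω → ℝ} (hp : ∀ ω, 0 ≤ p ω)
    (X : Ω → α) {ω : Ω} (hω : 0 < p ω) : 0 < probOf p X (X ω) :=
  Finset.sum_pos' (fun ω' _ => by split_ifs <;> simp [hp])
    ⟨ω, Finset.mem_univ _, by simpa using hω⟩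

theorem sum_probOf_pair {Ω α β : Type} [Fintype Ω] [Fintype α] (p : Ω → ℝ)
    (X : Ω → α) (C : Ω → β) (c : β) :
    ∑ x, probOf p (fun ω => (X ω, C ω)) (x, c) = probOf p C c := by
  simp only [probOf]
  rw [Finset.sum_comm]
  refine Finset.sum_congr rfl fun ω _ => ?_
  by_cases h : C ω = c <;> simp [h]

theorem Hent_eq_sum {Ω α : Type} [Fintype Ω] [Fintype α] (p : Ω → ℝ) (X : Ω → α) :
    Hent p X = -∑ ω, p ω * Real.log (probOf p X (X ω)) := by
  rw [Hent, sum_probOf_mul p X fun x => Real.log (probOf p X x)]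

/-- Entropy depends only on the partition of the sample space induced by the variable. -/
theorem Hent_congr {Ω α β : Type} [Fintype Ω] [Fintype α] [Fintype β] (p : Ω → ℝ)
    {X : Ω → α} {X' : Ω → β} (h : ∀ ω ω', X ω = X ω' ↔ X' ω = X' ω') :
    Hent p X = Hent p X' := by
  simp only [Hent_eq_sum, probOf, h]

/-- Conditioning on a function of a variable leaves at least as much entropy as conditioning on
the variable itself. -/
theorem condHent_le_condHent_comp {Ω β γ δ : Type} [Fintype Ω] [Fintype β] [Fintype γ]
    [Fintype δ] {p : Ω → ℝ} (hp : ∀ ω, 0 ≤ p ω) (Y : Ω → β) (C : Ω → γ) (f : γ → δ) :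
    condHent p Y C ≤ condHent p Y (fun ω => f (C ω)) := by
  set a := probOf p (fun ω => (Y ω, C ω))
  set b := probOf p C
  set c := probOf p (fun ω => (Y ω, f (C ω)))
  set d := probOf p (fun ω => f (C ω))
  have ha0 : ∀ x, 0 ≤ a x := probOf_nonneg hp _
  have hb0 : ∀ x, 0 ≤ b x := probOf_nonneg hp _
  have hc0 : ∀ x, 0 ≤ c x := probOf_nonneg hp _
  have hd0 : ∀ x, 0 ≤ d x := probOf_nonneg hp _
  have hsum : ∑ ω, p ω * (b (C ω) * c (Y ω, f (C ω)) / (a (Y ω, C ω) * d (f (C ω)))) ≤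
      ∑ ω, p ω := by
    rw [← sum_probOf_mul p (fun ω => (Y ω, C ω))
      fun x => b x.2 * c (x.1, f x.2) / (a x * d (f x.2))]
    calc ∑ x, a x * (b x.2 * c (x.1, f x.2) / (a x * d (f x.2)))
        ≤ ∑ x : β × γ, b x.2 / d (f x.2) * c (x.1, f x.2) := by
          refine Finset.sum_le_sum fun x _ => ?_
          rcases (ha0 x).eq_or_lt with h | h
          · rw [← h, zero_mul]
            exact mul_nonneg (div_nonneg (hb0 _) (hd0 _)) (hc0 _)
          · refine le_of_eq ?_
            rw [mul_div_assoc', mul_div_mul_left _ _ h.ne', div_mul_eq_mul_div]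
      _ = ∑ z, b z / d (f z) * d (f z) := by
          rw [Fintype.sum_prod_type_right]
          refine Finset.sum_congr rfl fun z _ => ?_
          dsimp only
          rw [← Finset.mul_sum]
          exact congrArg _ (sum_probOf_pair p Y (fun ω => f (C ω)) (f z))
      _ ≤ ∑ z, b z * 1 := by
          refine Finset.sum_le_sum fun z _ => ?_
          rw [div_mul_eq_mul_div, mul_div_assoc]
          exact mul_le_mul_of_nonneg_left (div_self_le_one _) (hb0 z)
      _ = ∑ ω, p ω := by
          rw [sum_probOf_mul p C fun _ => 1]
          simp
  have hterm : ∀ ω, p ω - p ω * (b (C ω) * c (Y ω, f (C ω)) / (a (Y ω, C ω) * d (f (C ω)))) ≤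
      p ω * Real.log (a (Y ω, C ω)) - p ω * Real.log (b (C ω)) -
        p ω * Real.log (c (Y ω, f (C ω))) + p ω * Real.log (d (f (C ω))) := by
    intro ω
    rcases (hp ω).eq_or_lt with h | h
    · simp [← h]
    · have ha1 : 0 < a (Y ω, C ω) := probOf_apply_pos hp (fun ω => (Y ω, C ω)) h
      have hb1 : 0 < b (C ω) := probOf_apply_pos hp C h
      have hc1 : 0 < c (Y ω, f (C ω)) := probOf_apply_pos hp (fun ω => (Y ω, f (C ω))) h
      have hd1 : 0 < d (f (C ω)) := probOf_apply_pos hp (fun ω => f (C ω)) h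
      have hlog := Real.log_le_sub_one_of_pos (div_pos (mul_pos hb1 hc1) (mul_pos ha1 hd1))
      rw [Real.log_div (by positivity) (by positivity), Real.log_mul hb1.ne' hc1.ne',
        Real.log_mul ha1.ne' hd1.ne'] at hlog
      have := mul_le_mul_of_nonneg_left hlog h.le
      linarith
  have htotal := Finset.sum_le_sum fun ω (_ : ω ∈ Finset.univ) => hterm ω
  simp only [Finset.sum_add_distrib, Finset.sum_sub_distrib] at htotal
  simp only [condHent, Hent_eq_sum]
  linarith

/-- The information `Y` carries about `X_U` given all the other coordinates. -/
theorem IcondMut_tup_compl {Ω ι β : Type} [Fintype Ω] [Fintype ι] [DecidableEq ι]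
    {𝒳 : ι → Type} [∀ k, Fintype (𝒳 k)] [Fintype β] (p : Ω → ℝ) (X : ∀ k, Ω → 𝒳 k)
    (Y : Ω → β) (U : Finset ι) :
    IcondMut p (tup X U) Y (tup X (Finset.univ \ U)) =
      condHent p Y (tup X (Finset.univ \ U)) - condHent p Y (fun ω k => X k ω) := by
  have hX : ∀ ω ω', (tup X U ω = tup X U ω' ∧
      tup X (Finset.univ \ U) ω = tup X (Finset.univ \ U) ω') ↔
        (fun k => X k ω) = (fun k => X k ω') := by
    intro ω ω'
    simp only [tup, funext_iff, Subtype.forall, Finset.mem_sdiff, Finset.mem_univ, true_and]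
    exact ⟨fun h k => (em (k ∈ U)).elim (h.1 k) (h.2 k),
      fun h => ⟨fun k _ => h k, fun k _ => h k⟩⟩
  have h₁ : Hent p (fun ω => (tup X U ω, tup X (Finset.univ \ U) ω)) =
      Hent p (fun ω k => X k ω) :=
    Hent_congr p fun ω ω' => by rw [Prod.mk.injEq, hX]
  have h₂ : Hent p (fun ω => ((tup X U ω, Y ω), tup X (Finset.univ \ U) ω)) =
      Hent p (fun ω => (Y ω, fun k => X k ω)) :=
    Hent_congr p fun ω ω' => by
      rw [Prod.mk.injEq, Prod.mk.injEq, Prod.mk.injEq, ← hX]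
      tauto
  simp only [IcondMut, condHent, h₁, h₂]
  ring

theorem IcondMut_tup_compl_mono {Ω ι β : Type} [Fintype Ω] [Fintype ι] [DecidableEq ι]
    {𝒳 : ι → Type} [∀ k, Fintype (𝒳 k)] [Fintype β] {p : Ω → ℝ} (hp : ∀ ω, 0 ≤ p ω)
    (X : ∀ k, Ω → 𝒳 k) (Y : Ω → β) {V U : Finset ι} (hVU : V ⊆ U) :
    IcondMut p (tup X V) Y (tup X (Finset.univ \ V)) ≤
      IcondMut p (tup X U) Y (tup X (Finset.univ \ U)) := by
  rw [IcondMut_tup_compl, IcondMut_tup_compl]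
  exact sub_le_sub_right (condHent_le_condHent_comp hp Y (tup X (Finset.univ \ V))
    fun x (k : (Finset.univ \ U : Finset ι)) =>
      x ⟨k.1, Finset.sdiff_subset_sdiff subset_rfl hVU k.2⟩) _

theorem stmt2 {K : ℕ} (hK : 1 ≤ K) {Ω : Type} [Fintype Ω]
    {𝒳 : Fin K → Type} [∀ k, Fintype (𝒳 k)] {𝒴 𝒵 : Type} [Fintype 𝒴] [Fintype 𝒵]
    (p : Ω → ℝ) (hp : IsPMF p)
    (X : ∀ k, Ω → 𝒳 k) (Y : Ω → 𝒴) (Z : Ω → 𝒵) (hind : MutIndep p X)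
    (K' : Finset (Fin K)) :
    (∀ S ⊆ K',
        0 ≤ IcondMut p (tup X S) Y (tup X (Finset.univ \ S)) -
              IcondMut p (tup X S) Z (tup X (Finset.univ \ K'))) ↔
      (∀ S ⊆ K', ∀ S' ⊆ S, ∀ T ⊆ Finset.univ \ K',
        0 ≤ IcondMut p (tup X (S ∪ T)) Y (tup X (Finset.univ \ (S ∪ T))) -
              IcondMut p (tup X S') Z (tup X (Finset.univ \ K'))) := by
  constructor
  · intro h S hS S' hS' T _
    exact (h S' (hS'.trans hS)).trans (sub_le_sub_right
      (IcondMut_tup_compl_mono hp.1 X Y (hS'.trans Finset.subset_union_left)) _)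
  · intro h S hS
    have hST := h S hS S subset_rfl ∅ (Finset.empty_subset _)
    rwa [Finset.union_empty] at hST
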